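/- arXiv:2108.03516 — 12 statements merged into one kernel-verified Lean document; each statement's English description precedes it below -/
import Mathlib

section
/- Let (X, S) be an S_b-metric space with coefficient b ≥ 1 and let f : X → X be a Jleli-Samet type D_{x₀}-S_b-contraction with center x₀ ∈ X, i.e., there exist α ∈ (0,1) and a nondecreasing function φ : (0,∞) → (1,∞) such that for every x ∈ X with f x ≠ x (equivalently S(x,x,f x) > 0) one has S(x,x,x₀) > 0 and φ(S(x,x,f x)) ≤ [φ(S(x,x,x₀))]^α. Let r = inf { S(x,x,f x) : x ∈ X, f x ≠ x }. Then f fixes the disc D^{S_b}_{x₀,r}, i.e., f x = x for every x ∈ X with S(x,x,x₀) ≤ r; in particular f x₀ = x₀. -/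
/-- Jleli-Samet type `D_{x₀}`-`S_b`-contraction fixes the disc `D^{S_b}_{x₀,r}`
where `r = inf { S(x,x,f x) : f x ≠ x }`; in particular `f x₀ = x₀`. -/
theorem fixed_disc_Sb {X : Type*} (b : ℝ) (hb : 1 ≤ b)
    (S : X → X → X → ℝ)
    (hS_nonneg : ∀ x y z : X, 0 ≤ S x y z)
    (hS1 : ∀ x y z : X, S x y z = 0 ↔ (x = y ∧ y = z))
    (hS2 : ∀ x y z a : X, S x y z ≤ b * (S x x a + S y y a + S z z a))
    (f : X → X) (x₀ : X)
    (α : ℝ) (hα : 0 < α ∧ α < 1)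
    (φ : ℝ → ℝ)
    (hφ_mono : ∀ s t : ℝ, 0 < s → s ≤ t → φ s ≤ φ t)
    (hφ_gt_one : ∀ t : ℝ, 0 < t → 1 < φ t)
    (hcontr : ∀ x : X, f x ≠ x →
      0 < S x x x₀ ∧ φ (S x x (f x)) ≤ (φ (S x x x₀)) ^ α)
    (r : ℝ) (hr : r = sInf {s : ℝ | ∃ x : X, f x ≠ x ∧ s = S x x (f x)}) :
    (∀ x : X, S x x x₀ ≤ r → f x = x) ∧ f x₀ = x₀ := by
  refine ⟨fun x hx => ?_, ?_⟩
  · by_contra hne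
    obtain ⟨hpos, hle⟩ := hcontr x hne
    have hbdd : BddBelow {s : ℝ | ∃ x : X, f x ≠ x ∧ s = S x x (f x)} :=
      ⟨0, by rintro _ ⟨y, -, rfl⟩; exact hS_nonneg _ _ _⟩
    have hr_le : r ≤ S x x (f x) := hr ▸ csInf_le hbdd ⟨x, hne, rfl⟩
    have hmono := hφ_mono _ _ hpos (hx.trans hr_le)
    have hlt := Real.rpow_lt_rpow_of_exponent_lt (hφ_gt_one _ hpos) hα.2
    rw [Real.rpow_one] at hlt
    linarith
  · by_contra hne
    exact (hcontr x₀ hne).1.ne' ((hS1 _ _ _).2 ⟨rfl, rfl⟩)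
end

section
/- Let (X, S) be an S_b-metric space with coefficient b ≥ 1 and let f : X → X be a Jleli-Samet type E_{x₁,x₂}-S_b-contraction, i.e., there exist x₁, x₂ ∈ X, α ∈ (0,1) and a nondecreasing function φ : (0,∞) → (1,∞) such that for every x ∈ X \ {x₁, x₂} with f x ≠ x (equivalently S(x,x,f x) > 0) one has φ(S(x,x,f x)) ≤ [φ(S(x,x,x₁) + S(x,x,x₂))]^α. Let r = inf { S(x,x,f x) : x ∈ X, f x ≠ x }. If f x₁ = x₁ and f x₂ = x₂, then f fixes the ellipse E^{S_b}_r(x₁,x₂), i.e., f x = x for every x ∈ X with S(x,x,x₁) + S(x,x,x₂) = r. -/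
/-- Jleli-Samet type `E_{x₁,x₂}`-`S_b`-contraction fixes the ellipse
`E^{S_b}_r(x₁,x₂)` provided `f x₁ = x₁` and `f x₂ = x₂`. -/
theorem fixed_ellipse_Sb {X : Type*} (b : ℝ) (hb : 1 ≤ b)
    (S : X → X → X → ℝ)
    (hS_nonneg : ∀ x y z : X, 0 ≤ S x y z)
    (hS1 : ∀ x y z : X, S x y z = 0 ↔ (x = y ∧ y = z))
    (hS2 : ∀ x y z a : X, S x y z ≤ b * (S x x a + S y y a + S z z a))
    (f : X → X) (x₁ x₂ : X)
    (α : ℝ) (hα : 0 < α ∧ α < 1)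
    (φ : ℝ → ℝ)
    (hφ_mono : ∀ s t : ℝ, 0 < s → s ≤ t → φ s ≤ φ t)
    (hφ_gt_one : ∀ t : ℝ, 0 < t → 1 < φ t)
    (hcontr : ∀ x : X, x ≠ x₁ → x ≠ x₂ → f x ≠ x →
      φ (S x x (f x)) ≤ (φ (S x x x₁ + S x x x₂)) ^ α)
    (r : ℝ) (hr : r = sInf {s : ℝ | ∃ x : X, f x ≠ x ∧ s = S x x (f x)})
    (hfx₁ : f x₁ = x₁) (hfx₂ : f x₂ = x₂) :
    ∀ x : X, S x x x₁ + S x x x₂ = r → f x = x := by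
  intro x hx
  by_contra hfx
  have hx₁ : x ≠ x₁ := fun h => hfx (h ▸ hfx₁)
  have hx₂ : x ≠ x₂ := fun h => hfx (h ▸ hfx₂)
  have hpos : 0 < S x x x₁ :=
    lt_of_le_of_ne (hS_nonneg _ _ _) fun h => hx₁ ((hS1 _ _ _).1 h.symm).2
  have hr_pos : 0 < r := by linarith [hS_nonneg x x x₂]
  have hr_le : r ≤ S x x (f x) := by
    rw [hr]
    refine csInf_le ⟨0, ?_⟩ ⟨x, hfx, rfl⟩
    rintro s ⟨y, -, rfl⟩
    exact hS_nonneg _ _ _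
  have hle := hcontr x hx₁ hx₂ hfx
  rw [hx] at hle
  have hlt : φ r ^ α < φ r := Real.rpow_lt_self_of_one_lt (hφ_gt_one r hr_pos) hα.2
  exact absurd ((hφ_mono r _ hr_pos hr_le).trans hle) hlt.not_ge
end

section
/- Let (X, S) be an S_b-metric space with coefficient b ≥ 1 and let f : X → X be a Jleli-Samet type H_{x₁,x₂}-S_b-contraction, i.e., there exist x₁, x₂ ∈ X, α ∈ (0,1) and a nondecreasing function φ : (0,∞) → (1,∞) such that for every x ∈ X \ {x₁, x₂} with f x ≠ x (equivalently S(x,x,f x) > 0) one has |S(x,x,x₁) − S(x,x,x₂)| > 0 and φ(S(x,x,f x)) ≤ [φ(|S(x,x,x₁) − S(x,x,x₂)|)]^α. Let r = inf { S(x,x,f x) : x ∈ X, f x ≠ x }. If f x₁ = x₁, f x₂ = x₂ and r > 0, then f fixes the hyperbola H^{S_b}_r(x₁,x₂), i.e., f x = x for every x ∈ X with |S(x,x,x₁) − S(x,x,x₂)| = r. -/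
/-- Jleli-Samet type `H_{x₁,x₂}`-`S_b`-contraction fixes the hyperbola
`H^{S_b}_r(x₁,x₂)` provided `f x₁ = x₁`, `f x₂ = x₂` and `r > 0`. -/
theorem fixed_hyperbola_Sb {X : Type*} (b : ℝ) (hb : 1 ≤ b)
    (S : X → X → X → ℝ)
    (hS_nonneg : ∀ x y z : X, 0 ≤ S x y z)
    (hS1 : ∀ x y z : X, S x y z = 0 ↔ (x = y ∧ y = z))
    (hS2 : ∀ x y z a : X, S x y z ≤ b * (S x x a + S y y a + S z z a))
    (f : X → X) (x₁ x₂ : X)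
    (α : ℝ) (hα : 0 < α ∧ α < 1)
    (φ : ℝ → ℝ)
    (hφ_mono : ∀ s t : ℝ, 0 < s → s ≤ t → φ s ≤ φ t)
    (hφ_gt_one : ∀ t : ℝ, 0 < t → 1 < φ t)
    (hcontr : ∀ x : X, x ≠ x₁ → x ≠ x₂ → f x ≠ x →
      0 < |S x x x₁ - S x x x₂| ∧
        φ (S x x (f x)) ≤ (φ |S x x x₁ - S x x x₂|) ^ α)
    (r : ℝ) (hr : r = sInf {s : ℝ | ∃ x : X, f x ≠ x ∧ s = S x x (f x)})
    (hfx₁ : f x₁ = x₁) (hfx₂ : f x₂ = x₂) (hrpos : 0 < r) :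
    ∀ x : X, |S x x x₁ - S x x x₂| = r → f x = x := by
  intro x hx
  by_contra hfx
  have hx₁ : x ≠ x₁ := by rintro rfl; exact hfx hfx₁
  have hx₂ : x ≠ x₂ := by rintro rfl; exact hfx hfx₂
  have hle : r ≤ S x x (f x) := by
    rw [hr]
    refine csInf_le ⟨0, ?_⟩ ⟨x, hfx, rfl⟩
    rintro s ⟨y, -, rfl⟩
    exact hS_nonneg y y (f y)
  have hφ_le := (hcontr x hx₁ hx₂ hfx).2
  rw [hx] at hφ_le
  have hlt : φ r ^ α < φ r := Real.rpow_lt_self_of_one_lt (hφ_gt_one r hrpos) hα.2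
  exact (((hφ_mono r _ hrpos hle).trans hφ_le).trans_lt hlt).false
end

section
/- Let (X, S) be an S_b-metric space with coefficient b ≥ 1 and let f : X → X be a Jleli-Samet type C_{x₁,x₂}-S_b-contraction, i.e., there exist x₁, x₂ ∈ X, α ∈ (0,1) and a nondecreasing function φ : (0,∞) → (1,∞) such that for every x ∈ X \ {x₁, x₂} with f x ≠ x (equivalently S(x,x,f x) > 0) one has φ(S(x,x,f x)) ≤ [φ(S(x,x,x₁) · S(x,x,x₂))]^α. Let r = inf { S(x,x,f x) : x ∈ X, f x ≠ x }. If f x₁ = x₁ and f x₂ = x₂, then f fixes the Cassini curve C^{S_b}_r(x₁,x₂), i.e., f x = x for every x ∈ X with S(x,x,x₁) · S(x,x,x₂) = r. -/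
/-- Jleli-Samet type `C_{x₁,x₂}`-`S_b`-contraction fixes the Cassini curve
`C^{S_b}_r(x₁,x₂)` provided `f x₁ = x₁` and `f x₂ = x₂`. -/
theorem fixed_cassini_Sb {X : Type*} (b : ℝ) (hb : 1 ≤ b)
    (S : X → X → X → ℝ)
    (hS_nonneg : ∀ x y z : X, 0 ≤ S x y z)
    (hS1 : ∀ x y z : X, S x y z = 0 ↔ (x = y ∧ y = z))
    (hS2 : ∀ x y z a : X, S x y z ≤ b * (S x x a + S y y a + S z z a))
    (f : X → X) (x₁ x₂ : X)
    (α : ℝ) (hα : 0 < α ∧ α < 1)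
    (φ : ℝ → ℝ)
    (hφ_mono : ∀ s t : ℝ, 0 < s → s ≤ t → φ s ≤ φ t)
    (hφ_gt_one : ∀ t : ℝ, 0 < t → 1 < φ t)
    (hcontr : ∀ x : X, x ≠ x₁ → x ≠ x₂ → f x ≠ x →
      φ (S x x (f x)) ≤ (φ (S x x x₁ * S x x x₂)) ^ α)
    (r : ℝ) (hr : r = sInf {s : ℝ | ∃ x : X, f x ≠ x ∧ s = S x x (f x)})
    (hfx₁ : f x₁ = x₁) (hfx₂ : f x₂ = x₂) :
    ∀ x : X, S x x x₁ * S x x x₂ = r → f x = x := by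
  intro x hx
  by_contra hfx
  have hx₁ : x ≠ x₁ := by
    rintro rfl
    exact hfx hfx₁
  have hx₂ : x ≠ x₂ := by
    rintro rfl
    exact hfx hfx₂
  have S_pos : ∀ y : X, x ≠ y → 0 < S x x y := fun y hy =>
    (hS_nonneg x x y).lt_of_ne' fun h => hy ((hS1 x x y).mp h).2
  have hr_pos : 0 < r := hx ▸ mul_pos (S_pos x₁ hx₁) (S_pos x₂ hx₂)
  have hr_le : r ≤ S x x (f x) := by
    rw [hr]
    refine csInf_le ⟨0, ?_⟩ ⟨x, hfx, rfl⟩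
    rintro _ ⟨y, -, rfl⟩
    exact hS_nonneg _ _ _
  have hφ_le : φ r ≤ φ r ^ α :=
    (hφ_mono _ _ hr_pos hr_le).trans (hx ▸ hcontr x hx₁ hx₂ hfx)
  exact hφ_le.not_gt (Real.rpow_lt_self_of_one_lt (hφ_gt_one r hr_pos) hα.2)
end

section
/- Let (X, S) be an S_b-metric space with coefficient b ≥ 1 and let f : X → X be a Jleli-Samet type A_{x₁,x₂}-S_b-contraction, i.e., there exist x₁, x₂ ∈ X, α ∈ (0,1) and a nondecreasing function φ : (0,∞) → (1,∞) such that for every x ∈ X \ {x₁, x₂} with f x ≠ x (equivalently S(x,x,f x) > 0) one has φ(S(x,x,f x)) ≤ [φ(S(x,x,x₁) / S(x,x,x₂))]^α. Let r = inf { S(x,x,f x) : x ∈ X, f x ≠ x }. If f x₁ = x₁ and f x₂ = x₂, then f fixes the Apollonius circle A^{S_b}_r(x₁,x₂), i.e., f x = x for every x ∈ X \ {x₂} with S(x,x,x₁) / S(x,x,x₂) = r. -/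
/-- Jleli-Samet type `A_{x₁,x₂}`-`S_b`-contraction fixes the Apollonius circle
`A^{S_b}_r(x₁,x₂)` provided `f x₁ = x₁` and `f x₂ = x₂`. -/
theorem fixed_apollonius_Sb {X : Type*} (b : ℝ) (hb : 1 ≤ b)
    (S : X → X → X → ℝ)
    (hS_nonneg : ∀ x y z : X, 0 ≤ S x y z)
    (hS1 : ∀ x y z : X, S x y z = 0 ↔ (x = y ∧ y = z))
    (hS2 : ∀ x y z a : X, S x y z ≤ b * (S x x a + S y y a + S z z a))
    (f : X → X) (x₁ x₂ : X)
    (α : ℝ) (hα : 0 < α ∧ α < 1)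
    (φ : ℝ → ℝ)
    (hφ_mono : ∀ s t : ℝ, 0 < s → s ≤ t → φ s ≤ φ t)
    (hφ_gt_one : ∀ t : ℝ, 0 < t → 1 < φ t)
    (hcontr : ∀ x : X, x ≠ x₁ → x ≠ x₂ → f x ≠ x →
      φ (S x x (f x)) ≤ (φ (S x x x₁ / S x x x₂)) ^ α)
    (r : ℝ) (hr : r = sInf {s : ℝ | ∃ x : X, f x ≠ x ∧ s = S x x (f x)})
    (hfx₁ : f x₁ = x₁) (hfx₂ : f x₂ = x₂) :
    ∀ x : X, x ≠ x₂ → S x x x₁ / S x x x₂ = r → f x = x := by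
  intro x hx₂ hxr
  by_contra hfx
  have hx₁ : x ≠ x₁ := fun h => hfx (h ▸ hfx₁)
  have S_pos : ∀ y : X, x ≠ y → 0 < S x x y := fun y hy =>
    (hS_nonneg x x y).lt_of_ne fun h => hy ((hS1 x x y).1 h.symm).2
  have hr_pos : 0 < r := hxr ▸ div_pos (S_pos x₁ hx₁) (S_pos x₂ hx₂)
  have hr_le : r ≤ S x x (f x) := by
    rw [hr]
    refine csInf_le ⟨0, ?_⟩ ⟨x, hfx, rfl⟩
    rintro _ ⟨y, -, rfl⟩
    exact hS_nonneg y y (f y)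
  have hφ_le : φ r ≤ φ r ^ α := by
    simpa only [hxr] using (hφ_mono r _ hr_pos hr_le).trans (hcontr x hx₁ hx₂ hfx)
  exact hφ_le.not_gt (Real.rpow_lt_self_of_one_lt (hφ_gt_one r hr_pos) hα.2)
end

section
/- Let (X, S) be an S-metric space (i.e., an S_b-metric space with coefficient b = 1) and let f : X → X be such that there exist x₁, x₂ ∈ X, α ∈ (0,1) and a nondecreasing function φ : (0,∞) → (1,∞) such that for every x ∈ X \ {x₁, x₂} with f x ≠ x (equivalently S(x,x,f x) > 0) one has φ(S(x,x,f x)) ≤ [φ(S(x,x,x₁) + S(x,x,x₂))]^α. Let r = inf { S(x,x,f x) : x ∈ X, f x ≠ x }. If f x₁ = x₁ and f x₂ = x₂, then f x = x for every x ∈ X with S(x,x,x₁) + S(x,x,x₂) = r. -/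
/-- Fixed-ellipse result on an `S`-metric space (the case `b = 1`). -/
theorem fixed_ellipse_S {X : Type*}
    (S : X → X → X → ℝ)
    (hS_nonneg : ∀ x y z : X, 0 ≤ S x y z)
    (hS1 : ∀ x y z : X, S x y z = 0 ↔ (x = y ∧ y = z))
    (hS2 : ∀ x y z a : X, S x y z ≤ S x x a + S y y a + S z z a)
    (f : X → X) (x₁ x₂ : X)
    (α : ℝ) (hα : 0 < α ∧ α < 1)
    (φ : ℝ → ℝ)
    (hφ_mono : ∀ s t : ℝ, 0 < s → s ≤ t → φ s ≤ φ t)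
    (hφ_gt_one : ∀ t : ℝ, 0 < t → 1 < φ t)
    (hcontr : ∀ x : X, x ≠ x₁ → x ≠ x₂ → f x ≠ x →
      φ (S x x (f x)) ≤ (φ (S x x x₁ + S x x x₂)) ^ α)
    (r : ℝ) (hr : r = sInf {s : ℝ | ∃ x : X, f x ≠ x ∧ s = S x x (f x)})
    (hfx₁ : f x₁ = x₁) (hfx₂ : f x₂ = x₂) :
    ∀ x : X, S x x x₁ + S x x x₂ = r → f x = x := by
  intro x hx
  by_contra hne
  have hx₁ : x ≠ x₁ := fun h => hne (h ▸ hfx₁)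
  have hx₂ : x ≠ x₂ := fun h => hne (h ▸ hfx₂)
  have hpos : 0 < S x x x₁ :=
    (hS_nonneg x x x₁).lt_of_ne fun h => hx₁ ((hS1 x x x₁).1 h.symm).2
  have hr_pos : 0 < r := by linarith [hS_nonneg x x x₂]
  have hr_le : r ≤ S x x (f x) := by
    rw [hr]
    refine csInf_le ⟨0, ?_⟩ ⟨x, hne, rfl⟩
    rintro _ ⟨y, -, rfl⟩
    exact hS_nonneg y y (f y)
  have hle := hcontr x hx₁ hx₂ hne
  rw [hx] at hle
  have hlt : φ r ^ α < φ r := Real.rpow_lt_self_of_one_lt (hφ_gt_one r hr_pos) hα.2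
  exact ((hφ_mono r _ hr_pos hr_le).trans hle).not_gt hlt
end

section
/- Let (X, S) be an S-metric space (i.e., an S_b-metric space with coefficient b = 1) and let f : X → X be such that there exist x₁, x₂ ∈ X, α ∈ (0,1) and a nondecreasing function φ : (0,∞) → (1,∞) such that for every x ∈ X \ {x₁, x₂} with f x ≠ x (equivalently S(x,x,f x) > 0) one has |S(x,x,x₁) − S(x,x,x₂)| > 0 and φ(S(x,x,f x)) ≤ [φ(|S(x,x,x₁) − S(x,x,x₂)|)]^α. Let r = inf { S(x,x,f x) : x ∈ X, f x ≠ x }. If f x₁ = x₁, f x₂ = x₂ and r > 0, then f x = x for every x ∈ X with |S(x,x,x₁) − S(x,x,x₂)| = r. -/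
/-- Fixed-hyperbola result on an `S`-metric space (the case `b = 1`). -/
theorem fixed_hyperbola_S {X : Type*}
    (S : X → X → X → ℝ)
    (hS_nonneg : ∀ x y z : X, 0 ≤ S x y z)
    (hS1 : ∀ x y z : X, S x y z = 0 ↔ (x = y ∧ y = z))
    (hS2 : ∀ x y z a : X, S x y z ≤ S x x a + S y y a + S z z a)
    (f : X → X) (x₁ x₂ : X)
    (α : ℝ) (hα : 0 < α ∧ α < 1)
    (φ : ℝ → ℝ)
    (hφ_mono : ∀ s t : ℝ, 0 < s → s ≤ t → φ s ≤ φ t)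
    (hφ_gt_one : ∀ t : ℝ, 0 < t → 1 < φ t)
    (hcontr : ∀ x : X, x ≠ x₁ → x ≠ x₂ → f x ≠ x →
      0 < |S x x x₁ - S x x x₂| ∧
        φ (S x x (f x)) ≤ (φ |S x x x₁ - S x x x₂|) ^ α)
    (r : ℝ) (hr : r = sInf {s : ℝ | ∃ x : X, f x ≠ x ∧ s = S x x (f x)})
    (hfx₁ : f x₁ = x₁) (hfx₂ : f x₂ = x₂) (hrpos : 0 < r) :
    ∀ x : X, |S x x x₁ - S x x x₂| = r → f x = x := by
  intro x hx
  by_contra hfx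
  have hx₁ : x ≠ x₁ := fun h => hfx (h ▸ hfx₁)
  have hx₂ : x ≠ x₂ := fun h => hfx (h ▸ hfx₂)
  obtain ⟨-, hle⟩ := hcontr x hx₁ hx₂ hfx
  rw [hx] at hle
  have hrle : r ≤ S x x (f x) := by
    rw [hr]
    refine csInf_le ⟨0, ?_⟩ ⟨x, hfx, rfl⟩
    rintro s ⟨y, -, rfl⟩
    exact hS_nonneg y y (f y)
  have hlt : φ r ^ α < φ r := Real.rpow_lt_self_of_one_lt (hφ_gt_one r hrpos) hα.2
  exact absurd (hφ_mono r _ hrpos hrle) (not_le.mpr (hle.trans_lt hlt))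
end

section
/- Let (X, S) be an S-metric space (i.e., an S_b-metric space with coefficient b = 1) and let f : X → X be such that there exist x₁, x₂ ∈ X, α ∈ (0,1) and a nondecreasing function φ : (0,∞) → (1,∞) such that for every x ∈ X \ {x₁, x₂} with f x ≠ x (equivalently S(x,x,f x) > 0) one has φ(S(x,x,f x)) ≤ [φ(S(x,x,x₁) · S(x,x,x₂))]^α. Let r = inf { S(x,x,f x) : x ∈ X, f x ≠ x }. If f x₁ = x₁ and f x₂ = x₂, then f x = x for every x ∈ X with S(x,x,x₁) · S(x,x,x₂) = r. -/
/-- Fixed-Cassini-curve result on an `S`-metric space (the case `b = 1`). -/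
theorem fixed_cassini_S {X : Type*}
    (S : X → X → X → ℝ)
    (hS_nonneg : ∀ x y z : X, 0 ≤ S x y z)
    (hS1 : ∀ x y z : X, S x y z = 0 ↔ (x = y ∧ y = z))
    (hS2 : ∀ x y z a : X, S x y z ≤ S x x a + S y y a + S z z a)
    (f : X → X) (x₁ x₂ : X)
    (α : ℝ) (hα : 0 < α ∧ α < 1)
    (φ : ℝ → ℝ)
    (hφ_mono : ∀ s t : ℝ, 0 < s → s ≤ t → φ s ≤ φ t)
    (hφ_gt_one : ∀ t : ℝ, 0 < t → 1 < φ t)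
    (hcontr : ∀ x : X, x ≠ x₁ → x ≠ x₂ → f x ≠ x →
      φ (S x x (f x)) ≤ (φ (S x x x₁ * S x x x₂)) ^ α)
    (r : ℝ) (hr : r = sInf {s : ℝ | ∃ x : X, f x ≠ x ∧ s = S x x (f x)})
    (hfx₁ : f x₁ = x₁) (hfx₂ : f x₂ = x₂) :
    ∀ x : X, S x x x₁ * S x x x₂ = r → f x = x := by
  intro x hx
  by_contra hne
  have hx₁ : x ≠ x₁ := fun h => hne (by rw [h, hfx₁])
  have hx₂ : x ≠ x₂ := fun h => hne (by rw [h, hfx₂])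
  have S_pos : ∀ y, x ≠ y → 0 < S x x y := fun y hy =>
    (hS_nonneg x x y).lt_of_ne' fun h => hy ((hS1 x x y).1 h).2
  have hpos : 0 < S x x x₁ * S x x x₂ := mul_pos (S_pos x₁ hx₁) (S_pos x₂ hx₂)
  have hle : S x x x₁ * S x x x₂ ≤ S x x (f x) := by
    rw [hx, hr]
    refine csInf_le ⟨0, ?_⟩ ⟨x, hne, rfl⟩
    rintro s ⟨y, -, rfl⟩
    exact hS_nonneg y y (f y)
  have hlt : φ (S x x x₁ * S x x x₂) ^ α < φ (S x x x₁ * S x x x₂) :=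
    Real.rpow_lt_self_of_one_lt (hφ_gt_one _ hpos) hα.2
  exact ((hφ_mono _ _ hpos hle).trans (hcontr x hx₁ hx₂ hne)).not_gt hlt
end

section
/- Let (X, S) be an S-metric space (i.e., an S_b-metric space with coefficient b = 1) and let f : X → X be such that there exist x₁, x₂ ∈ X, α ∈ (0,1) and a nondecreasing function φ : (0,∞) → (1,∞) such that for every x ∈ X \ {x₁, x₂} with f x ≠ x (equivalently S(x,x,f x) > 0) one has φ(S(x,x,f x)) ≤ [φ(S(x,x,x₁) / S(x,x,x₂))]^α. Let r = inf { S(x,x,f x) : x ∈ X, f x ≠ x }. If f x₁ = x₁ and f x₂ = x₂, then f x = x for every x ∈ X \ {x₂} with S(x,x,x₁) / S(x,x,x₂) = r. -/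
/-- Fixed-Apollonius-circle result on an `S`-metric space (the case `b = 1`). -/
theorem fixed_apollonius_S {X : Type*}
    (S : X → X → X → ℝ)
    (hS_nonneg : ∀ x y z : X, 0 ≤ S x y z)
    (hS1 : ∀ x y z : X, S x y z = 0 ↔ (x = y ∧ y = z))
    (hS2 : ∀ x y z a : X, S x y z ≤ S x x a + S y y a + S z z a)
    (f : X → X) (x₁ x₂ : X)
    (α : ℝ) (hα : 0 < α ∧ α < 1)
    (φ : ℝ → ℝ)
    (hφ_mono : ∀ s t : ℝ, 0 < s → s ≤ t → φ s ≤ φ t)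
    (hφ_gt_one : ∀ t : ℝ, 0 < t → 1 < φ t)
    (hcontr : ∀ x : X, x ≠ x₁ → x ≠ x₂ → f x ≠ x →
      φ (S x x (f x)) ≤ (φ (S x x x₁ / S x x x₂)) ^ α)
    (r : ℝ) (hr : r = sInf {s : ℝ | ∃ x : X, f x ≠ x ∧ s = S x x (f x)})
    (hfx₁ : f x₁ = x₁) (hfx₂ : f x₂ = x₂) :
    ∀ x : X, x ≠ x₂ → S x x x₁ / S x x x₂ = r → f x = x := by
  intro x hx₂ hx
  by_contra hfx
  have hx₁ : x ≠ x₁ := by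
    rintro rfl
    exact hfx hfx₁
  have S_pos : ∀ y : X, x ≠ y → 0 < S x x y := fun y hy =>
    (hS_nonneg x x y).lt_of_ne' fun h => hy ((hS1 x x y).1 h).2
  have hr_pos : 0 < r := hx ▸ div_pos (S_pos x₁ hx₁) (S_pos x₂ hx₂)
  have hr_le : r ≤ S x x (f x) := by
    rw [hr]
    refine csInf_le ⟨0, ?_⟩ ⟨x, hfx, rfl⟩
    rintro s ⟨y, -, rfl⟩
    exact hS_nonneg y y (f y)
  have hcontr_x := hcontr x hx₁ hx₂ hfx
  rw [hx] at hcontr_x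
  have hpow : φ r ^ α < φ r := Real.rpow_lt_self_of_one_lt (hφ_gt_one r hr_pos) hα.2
  exact absurd ((hφ_mono r _ hr_pos hr_le).trans hcontr_x) hpow.not_ge
end

section
/- Let (X, S) be an S_b-metric space with coefficient b ≥ 1 such that S is symmetric, i.e., S(x,x,y) = S(y,y,x) for all x, y ∈ X. Define d : X × X → [0,∞) by d(x,y) = S(x,x,y). Then d is a b-metric on X: d(x,y) = 0 if and only if x = y; d(x,y) = d(y,x) for all x, y; and d(x,z) ≤ 2b·[d(x,y) + d(y,z)] for all x, y, z ∈ X. -/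
/-- From a symmetric `S_b`-metric `S`, the function `d(x,y) = S(x,x,y)` is a
`b`-metric with coefficient `2b`. -/
theorem b_metric_of_Sb_metric {X : Type*} (b : ℝ) (hb : 1 ≤ b)
    (S : X → X → X → ℝ)
    (hS_nonneg : ∀ x y z : X, 0 ≤ S x y z)
    (hS1 : ∀ x y z : X, S x y z = 0 ↔ (x = y ∧ y = z))
    (hS2 : ∀ x y z a : X, S x y z ≤ b * (S x x a + S y y a + S z z a))
    (hsymm : ∀ x y : X, S x x y = S y y x)
    (d : X → X → ℝ) (hd : ∀ x y : X, d x y = S x x y) :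
    (∀ x y : X, 0 ≤ d x y) ∧
    (∀ x y : X, d x y = 0 ↔ x = y) ∧
    (∀ x y : X, d x y = d y x) ∧
    (∀ x y z : X, d x z ≤ 2 * b * (d x y + d y z)) := by
  simp only [hd]
  refine ⟨fun x y => hS_nonneg x x y, fun x y => by simp [hS1], hsymm, fun x y z => ?_⟩
  have h := hS2 x x z y
  rw [hsymm z y] at h
  have h_nonneg : 0 ≤ b * S y y z := mul_nonneg (by linarith) (hS_nonneg y y z)
  linarith
end

section
/- Let (X, d) be a metric space and let p > 1 be a real number. Define S : X × X × X → [0,∞) by S(x,y,z) = [d(x,y) + d(y,z) + d(x,z)]^p. Then S is an S_b-metric on X with coefficient b = 3^{p−1}: S(x,y,z) = 0 if and only if x = y = z, and S(x,y,z) ≤ 3^{p−1}·[S(x,x,a) + S(y,y,a) + S(z,z,a)] for all x, y, z, a ∈ X. -/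
/-- For a metric space `(X, d)` and a real `p > 1`, the function
`S(x,y,z) = (d(x,y) + d(y,z) + d(x,z))^p` is an `S_b`-metric on `X` with
coefficient `b = 3^(p−1)`. -/
theorem Sb_metric_of_metric_pow {X : Type*} [MetricSpace X]
    (p : ℝ) (hp : 1 < p)
    (S : X → X → X → ℝ)
    (hS : ∀ x y z : X, S x y z = (dist x y + dist y z + dist x z) ^ p) :
    (∀ x y z : X, 0 ≤ S x y z) ∧
    (∀ x y z : X, S x y z = 0 ↔ (x = y ∧ y = z)) ∧
    (∀ x y z a : X, S x y z ≤ (3 : ℝ) ^ (p - 1) * (S x x a + S y y a + S z z a)) := by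
  have hsum (x y z : X) : 0 ≤ dist x y + dist y z + dist x z := by positivity
  refine ⟨fun x y z ↦ ?_, fun x y z ↦ ?_, fun x y z a ↦ ?_⟩
  · rw [hS]
    exact Real.rpow_nonneg (hsum x y z) p
  · rw [hS, Real.rpow_eq_zero (hsum x y z) (by positivity)]
    constructor
    · intro h
      have hxy := dist_nonneg (x := x) (y := y)
      have hyz := dist_nonneg (x := y) (y := z)
      have hxz := dist_nonneg (x := x) (y := z)
      exact ⟨dist_le_zero.1 (by linarith), dist_le_zero.1 (by linarith)⟩
    · rintro ⟨rfl, rfl⟩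
      simp
  · have hdist : dist x y + dist y z + dist x z ≤
        (dist x a + dist x a) + (dist y a + dist y a) + (dist z a + dist z a) := by
      linarith [dist_triangle_right x y a, dist_triangle_right y z a,
        dist_triangle_right x z a]
    have hmean := Real.rpow_sum_le_const_mul_sum_rpow_of_nonneg (Finset.univ : Finset (Fin 3))
      (f := fun i ↦ dist (![x, y, z] i) a + dist (![x, y, z] i) a) hp.le
      (fun i _ ↦ by positivity)
    simp only [hS, dist_self, zero_add]
    refine (Real.rpow_le_rpow (hsum x y z) hdist (by positivity)).trans ?_
    simpa [Fin.sum_univ_three] using hmean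
end

section
/- Define S : ℝ × ℝ × ℝ → [0,∞) by S(x,y,z) = |x−z| + |x+z−2y|. Then S is an S-metric on ℝ: S(x,y,z) = 0 if and only if x = y = z, and S(x,y,z) ≤ S(x,x,a) + S(y,y,a) + S(z,z,a) for all x, y, z, a ∈ ℝ. -/
/-- The function `S(x,y,z) = |x−z| + |x+z−2y|`. -/
def Smet (x y z : ℝ) : ℝ := |x - z| + |x + z - 2 * y|

/-- `Smet` is an `S`-metric on `ℝ`. -/
theorem Smet_is_S_metric :
    (∀ x y z : ℝ, 0 ≤ Smet x y z) ∧
    (∀ x y z : ℝ, Smet x y z = 0 ↔ (x = y ∧ y = z)) ∧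
    (∀ x y z a : ℝ, Smet x y z ≤ Smet x x a + Smet y y a + Smet z z a) := by
  refine ⟨fun x y z => by unfold Smet; positivity, fun x y z => ⟨fun h => ?_, ?_⟩,
    fun x y z a => ?_⟩
  · obtain ⟨h₁, h₂⟩ := (add_eq_zero_iff_of_nonneg (abs_nonneg _) (abs_nonneg _)).mp h
    rw [abs_eq_zero] at h₁ h₂
    constructor <;> linarith
  · rintro ⟨rfl, rfl⟩
    simp [Smet, two_mul]
  · have smet_self (t : ℝ) : Smet t t a = 2 * |t - a| := by
      rw [Smet, show t + a - 2 * t = -(t - a) by ring, abs_neg, two_mul]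
    rw [smet_self, smet_self, smet_self, Smet]
    have hx := abs_le.mp (le_refl |x - a|)
    have hy := abs_le.mp (le_refl |y - a|)
    have hz := abs_le.mp (le_refl |z - a|)
    rcases abs_cases (x - z) with ⟨h₁, _⟩ | ⟨h₁, _⟩ <;>
      rcases abs_cases (x + z - 2 * y) with ⟨h₂, _⟩ | ⟨h₂, _⟩ <;>
      rw [h₁, h₂] <;>
      linarith [abs_nonneg (x - a), abs_nonneg (z - a)]
end
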